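/- Commutator smallness for Littlewood–Paley projections against a smooth weight: if w(x) = ⟨x⟩^{−σ} with σ > 0 and Δ_k is a Littlewood–Paley projection at frequency 2^k, then the commutator satisfies ‖w^{−1}[Δ_k, w]f‖_{L²(ℝ³)} ≲ 2^{−k}‖f‖_{L²(ℝ³)} uniformly in k ≥ 1. -/

import Mathlib

open MeasureTheory FourierTransform SchwartzMap

theorem abs_pow_sub_one_le {r R : ℝ} (hr : 0 ≤ r) (hrR : r ≤ R) (hR : 1 ≤ R) (n : ℕ) :
    |r ^ n - 1| ≤ n * |r - 1| * R ^ n := by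
  induction n with
  | zero => simp
  | succ n ih =>
    have hRn : 1 ≤ R ^ (n + 1) := one_le_pow₀ hR
    calc |r ^ (n + 1) - 1| = |r * (r ^ n - 1) + (r - 1)| := by ring_nf
      _ ≤ |r * (r ^ n - 1)| + |r - 1| := abs_add_le _ _
      _ = r * |r ^ n - 1| + |r - 1| := by rw [abs_mul, abs_of_nonneg hr]
      _ ≤ R * (n * |r - 1| * R ^ n) + |r - 1| * R ^ (n + 1) := by
          gcongr
          exact le_mul_of_one_le_right (abs_nonneg _) hRn
      _ = (n + 1 : ℕ) * |r - 1| * R ^ (n + 1) := by push_cast; ring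

theorem abs_rpow_sub_one_le_abs_pow_sub_one {r s : ℝ} (hr : 0 < r) (hs : 0 ≤ s) {n : ℕ}
    (hsn : s ≤ n) : |r ^ s - 1| ≤ |r ^ n - 1| := by
  rcases le_total 1 r with h | h
  · have h1 : 1 ≤ r ^ s := Real.one_le_rpow h hs
    have h2 : r ^ s ≤ r ^ n := by
      rw [← Real.rpow_natCast]; exact Real.rpow_le_rpow_of_exponent_le h hsn
    rw [abs_of_nonneg (by linarith), abs_of_nonneg (by linarith)]
    linarith
  · have h1 : r ^ s ≤ 1 := Real.rpow_le_one hr.le h hs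
    have h2 : r ^ n ≤ r ^ s := by
      rw [← Real.rpow_natCast]; exact Real.rpow_le_rpow_of_exponent_ge hr h hsn
    rw [abs_of_nonpos (by linarith), abs_of_nonpos (by linarith)]
    linarith

theorem abs_one_add_norm_sq_div_sub_one_le {E : Type*} [NormedAddCommGroup E] (x y : E) :
    |(1 + ‖x‖ ^ 2) / (1 + ‖y‖ ^ 2) - 1| ≤ ‖x - y‖ * (1 + ‖x - y‖) := by
  have hy : 0 < 1 + ‖y‖ ^ 2 := by positivity
  have h1 : |‖x‖ - ‖y‖| ≤ ‖x - y‖ := abs_norm_sub_norm_le x y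
  have h2 : ‖x‖ + ‖y‖ ≤ ‖x - y‖ + 2 * ‖y‖ := by linarith [(abs_le.1 h1).2]
  rw [div_sub_one hy.ne', abs_div, abs_of_pos hy, div_le_iff₀ hy]
  have h3 : (1 + ‖x‖ ^ 2) - (1 + ‖y‖ ^ 2) = (‖x‖ - ‖y‖) * (‖x‖ + ‖y‖) := by ring
  rw [h3, abs_mul, abs_of_nonneg (add_nonneg (norm_nonneg x) (norm_nonneg y)), mul_assoc]
  gcongr
  nlinarith [norm_nonneg (x - y), sq_nonneg (‖y‖ - 1), sq_nonneg ‖y‖,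
    mul_nonneg (norm_nonneg (x - y)) (sq_nonneg ‖y‖)]

/-- Difference form of Peetre's inequality for the weight `⟨x⟩^{-2s}`. -/
theorem abs_one_add_norm_sq_div_rpow_sub_one_le {E : Type*} [NormedAddCommGroup E]
    {s : ℝ} (hs : 0 ≤ s) {n : ℕ} (hsn : s ≤ n) (x y : E) :
    |((1 + ‖x‖ ^ 2) / (1 + ‖y‖ ^ 2)) ^ s - 1| ≤
      n * (‖x - y‖ * (1 + ‖x - y‖) ^ (2 * n + 1)) := by
  set r := (1 + ‖x‖ ^ 2) / (1 + ‖y‖ ^ 2)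
  set d := ‖x - y‖
  have hd : 0 ≤ d := norm_nonneg _
  have hr : 0 < r := by positivity
  have hr1 : |r - 1| ≤ d * (1 + d) := abs_one_add_norm_sq_div_sub_one_le x y
  have hrR : r ≤ (1 + d) ^ 2 := by nlinarith [(abs_le.1 hr1).2]
  have hR : 1 ≤ (1 + d) ^ 2 := by nlinarith
  calc |r ^ s - 1| ≤ |r ^ n - 1| := abs_rpow_sub_one_le_abs_pow_sub_one hr hs hsn
    _ ≤ n * |r - 1| * ((1 + d) ^ 2) ^ n := abs_pow_sub_one_le hr.le hrR hR n
    _ ≤ n * (d * (1 + d)) * ((1 + d) ^ 2) ^ n := by gcongr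
    _ = n * (d * (1 + d) ^ (2 * n + 1)) := by rw [← pow_mul]; ring

/-- Young's convolution inequality `L¹ * L² ⊆ L²` for nonnegative functions. -/
theorem lintegral_sq_lconvolution_le {G : Type*} [AddCommGroup G] [MeasurableSpace G]
    [MeasurableAdd₂ G] [MeasurableNeg G] (μ : Measure G) [SFinite μ] [μ.IsAddLeftInvariant]
    [μ.IsNegInvariant] {g h : G → ENNReal} (hg : Measurable g) (hh : Measurable h) :
    ∫⁻ x, (∫⁻ y, g (x - y) * h y ∂μ) ^ (2 : ℝ) ∂μ ≤
      (∫⁻ x, g x ∂μ) ^ (2 : ℝ) * ∫⁻ x, h x ^ (2 : ℝ) ∂μ := by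
  have hgm : Measurable fun p : G × G => g (p.1 - p.2) :=
    hg.comp (measurable_fst.sub measurable_snd)
  have key (x : G) : (∫⁻ y, g (x - y) * h y ∂μ) ^ (2 : ℝ) ≤
      (∫⁻ y, g y ∂μ) * ∫⁻ y, g (x - y) * h y ^ (2 : ℝ) ∂μ := by
    have hgx : Measurable fun y => g (x - y) := hg.comp (measurable_const.sub measurable_id)
    have hsq (a : ENNReal) : (a ^ (1 / 2 : ℝ)) ^ (2 : ℝ) = a := by
      rw [← ENNReal.rpow_mul]; norm_num
    have H := ENNReal.lintegral_mul_le_Lp_mul_Lq μ Real.HolderConjugate.two_two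
      (f := fun y => g (x - y) ^ (1 / 2 : ℝ)) (g := fun y => g (x - y) ^ (1 / 2 : ℝ) * h y)
      (hgx.pow_const _).aemeasurable ((hgx.pow_const _).mul hh).aemeasurable
    have e1 (y : G) : ((fun y => g (x - y) ^ (1 / 2 : ℝ)) *
        fun y => g (x - y) ^ (1 / 2 : ℝ) * h y) y = g (x - y) * h y := by
      simp only [Pi.mul_apply]
      rw [← mul_assoc, ← ENNReal.rpow_add_of_nonneg _ _ (by norm_num) (by norm_num)]
      norm_num
    simp only [e1, hsq, ENNReal.mul_rpow_of_nonneg _ _ (zero_le_two : (0 : ℝ) ≤ 2)] at H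
    calc _ ≤ _ := ENNReal.rpow_le_rpow H zero_le_two
      _ = _ := by
        rw [ENNReal.mul_rpow_of_nonneg _ _ zero_le_two, hsq, hsq, lintegral_sub_left_eq_self]
  calc _ ≤ ∫⁻ x, (∫⁻ y, g y ∂μ) * ∫⁻ y, g (x - y) * h y ^ (2 : ℝ) ∂μ ∂μ := lintegral_mono key
    _ = (∫⁻ y, g y ∂μ) * ∫⁻ y, ∫⁻ x, g (x - y) * h y ^ (2 : ℝ) ∂μ ∂μ := by
      have hm : Measurable fun p : G × G => g (p.1 - p.2) * h p.2 ^ (2 : ℝ) :=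
        hgm.mul ((hh.comp measurable_snd).pow_const _)
      rw [lintegral_const_mul _ hm.lintegral_prod_right', lintegral_lintegral_swap hm.aemeasurable]
    _ = (∫⁻ y, g y ∂μ) * ∫⁻ y, (∫⁻ x, g x ∂μ) * h y ^ (2 : ℝ) ∂μ := by
      congr 2 with y
      have hgy : Measurable fun x => g (x - y) := hg.comp (measurable_id.sub measurable_const)
      rw [lintegral_mul_const _ hgy, lintegral_sub_right_eq_self]
    _ = _ := by
      rw [lintegral_const_mul _ (hh.pow_const _), ← mul_assoc, ENNReal.rpow_two, sq]

section

variable {V : Type*} [NormedAddCommGroup V] [InnerProductSpace ℝ V] [FiniteDimensional ℝ V]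
  [MeasurableSpace V] [BorelSpace V]

theorem lintegral_comp_smul_addHaar (μ : Measure V) [μ.IsAddHaarMeasure] {g : V → ENNReal}
    (hg : Measurable g) {r : ℝ} (hr : r ≠ 0) :
    ∫⁻ x, g (r • x) ∂μ = ENNReal.ofReal |(r ^ Module.finrank ℝ V)⁻¹| * ∫⁻ x, g x ∂μ := by
  rw [← lintegral_map hg (measurable_const_smul r), Measure.map_addHaar_smul μ hr,
    lintegral_smul_measure, smul_eq_mul]

/-- A Fourier multiplier with integrable symbol is convolution with its kernel. -/
theorem fourierInv_mul_fourier_eq_integral {m g : V → ℂ} (hm : Integrable m) (hg : Integrable g)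
    (x : V) : 𝓕⁻ (fun ξ => m ξ * 𝓕 g ξ) x = ∫ y, 𝓕⁻ m (x - y) * g y := by
  have hM : Integrable fun ξ => 𝐞 (inner ℝ ξ x) • m ξ := by
    have := (Real.fourierIntegral_convergent_iff (μ := volume) (f := m) (-x)).2 hm
    simpa using this
  have H := VectorFourier.integral_fourierIntegral_smul_eq_flip (L := innerₗ V)
    Real.continuous_fourierChar continuous_inner hg hM
  rw [Real.fourierInv_eq]
  calc _ = ∫ ξ, 𝓕 g ξ • (𝐞 (inner ℝ ξ x) • m ξ) := by
        congr with ξ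
        simp only [Circle.smul_def, smul_eq_mul]; ring
    _ = _ := H
    _ = _ := by
        congr with y
        rw [Real.fourierInv_eq, smul_eq_mul, mul_comm]
        congr 1
        simp only [VectorFourier.fourierIntegral]
        congr with ξ
        rw [smul_smul, ← AddChar.map_add_eq_mul]
        congr 2
        simp [inner_sub_right, real_inner_comm]
        ring

theorem fourierInv_comp_inv_smul (m : V → ℂ) {r : ℝ} (hr : 0 < r) (x : V) :
    𝓕⁻ (fun ξ => m (r⁻¹ • ξ)) x = ((r ^ Module.finrank ℝ V : ℝ) : ℂ) * 𝓕⁻ m (r • x) := by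
  rw [Real.fourierInv_eq, Real.fourierInv_eq]
  have := Measure.integral_comp_inv_smul volume (fun ξ => 𝐞 (inner ℝ ξ (r • x)) • m ξ) r
  rw [abs_of_pos (pow_pos hr _), Complex.real_smul] at this
  rw [← this]
  congr with ξ
  rw [real_inner_smul_left, real_inner_smul_right, inv_mul_cancel_left₀ hr.ne']

theorem integrable_norm_mul_one_add_norm_pow_mul (K : 𝓢(V, ℂ)) (n : ℕ) :
    Integrable fun z : V => ‖z‖ * (1 + ‖z‖) ^ n * ‖K z‖ := by
  have h : Integrable fun z : V => 2 ^ n * (‖z‖ ^ 1 * ‖K z‖ + ‖z‖ ^ (n + 1) * ‖K z‖) :=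
    ((K.integrable_pow_mul volume 1).add (K.integrable_pow_mul volume (n + 1))).const_mul _
  refine h.mono' (by fun_prop) (.of_forall fun z => ?_)
  rw [Real.norm_of_nonneg (by positivity)]
  have hz := norm_nonneg z
  have : (1 + ‖z‖) ^ n ≤ 2 ^ n * (1 + ‖z‖ ^ n) := by
    rcases le_total ‖z‖ 1 with h | h
    · calc (1 + ‖z‖) ^ n ≤ 2 ^ n := by gcongr; linarith
        _ ≤ _ := le_mul_of_one_le_right (by positivity) (by simp)
    · calc (1 + ‖z‖) ^ n ≤ (2 * ‖z‖) ^ n := by gcongr; linarith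
        _ = 2 ^ n * ‖z‖ ^ n := mul_pow _ _ _
        _ ≤ _ := by gcongr; simp
  calc _ ≤ ‖z‖ * (2 ^ n * (1 + ‖z‖ ^ n)) * ‖K z‖ := by gcongr
    _ = _ := by ring

end

/-- Commutator smallness for Littlewood–Paley projections against the smooth weight
`w(x) = ⟨x⟩^{−σ}`: with `Δ_k f = 𝓕⁻¹(φ(2^{−k}·)𝓕f)` for a radial bump `φ` supported in
`{1/2 < |ξ| < 2}`, one has `‖w⁻¹[Δ_k, w]f‖_{L²} ≲ 2^{−k}‖f‖_{L²}` uniformly in `k ≥ 1`. -/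
theorem littlewoodPaley_commutator_weight
    (φ : EuclideanSpace ℝ (Fin 3) → ℝ) (hφsm : ContDiff ℝ (⊤ : ℕ∞) φ)
    (hφc : HasCompactSupport φ)
    (hφsupp : ∀ ξ, φ ξ ≠ 0 → 1 / 2 < ‖ξ‖ ∧ ‖ξ‖ < 2)
    (hφrad : ∀ ξ η : EuclideanSpace ℝ (Fin 3), ‖ξ‖ = ‖η‖ → φ ξ = φ η)
    (σ : ℝ) (hσ : 0 < σ)
    (w : EuclideanSpace ℝ (Fin 3) → ℝ)
    (hw : ∀ x, w x = (1 + ‖x‖ ^ 2) ^ (-σ / 2 : ℝ))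
    (Δ : ℕ → (EuclideanSpace ℝ (Fin 3) → ℂ) → EuclideanSpace ℝ (Fin 3) → ℂ)
    (hΔ : ∀ (k : ℕ) (g : EuclideanSpace ℝ (Fin 3) → ℂ),
      Δ k g = 𝓕⁻ fun ξ => ((φ (((2 : ℝ) ^ (-(k : ℤ))) • ξ) : ℝ) : ℂ) * 𝓕 g ξ) :
    ∃ C > 0, ∀ k : ℕ, 1 ≤ k → ∀ f : 𝓢(EuclideanSpace ℝ (Fin 3), ℂ),
      eLpNorm (fun x => ((w x : ℂ))⁻¹ *
          (Δ k (fun y => ((w y : ℝ) : ℂ) * f y) x - ((w x : ℝ) : ℂ) * Δ k (⇑f) x))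
        2 volume
      ≤ ENNReal.ofReal (C * (2 : ℝ) ^ (-(k : ℤ))) * eLpNorm (⇑f) 2 volume := by
  set n : ℕ := ⌈σ / 2⌉₊
  have hΦc : HasCompactSupport fun ξ => (φ ξ : ℂ) :=
    hφc.comp_left (g := ((↑) : ℝ → ℂ)) Complex.ofReal_zero
  have hΦsm : ContDiff ℝ (⊤ : ℕ∞) fun ξ => (φ ξ : ℂ) := Complex.ofRealCLM.contDiff.comp hφsm
  set Φ : 𝓢(EuclideanSpace ℝ (Fin 3), ℂ) := hΦc.toSchwartzMap hΦsm
  set K : 𝓢(EuclideanSpace ℝ (Fin 3), ℂ) := 𝓕⁻ Φ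
  set P : EuclideanSpace ℝ (Fin 3) → ℝ := fun z => ‖z‖ * (1 + ‖z‖) ^ (2 * n + 1) * ‖K z‖
  have hP0 (z : EuclideanSpace ℝ (Fin 3)) : 0 ≤ P z := by positivity
  have hPi : Integrable P := integrable_norm_mul_one_add_norm_pow_mul K (2 * n + 1)
  have hw0 (x : EuclideanSpace ℝ (Fin 3)) : 0 < w x := by rw [hw]; positivity
  have hwc : Continuous w := by
    rw [funext hw]
    exact (by fun_prop : Continuous fun x : EuclideanSpace ℝ (Fin 3) => 1 + ‖x‖ ^ 2).rpow_const
      fun x => .inl (by positivity)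
  have hw1 (x : EuclideanSpace ℝ (Fin 3)) : w x ≤ 1 := by
    rw [hw]
    exact Real.rpow_le_one_of_one_le_of_nonpos (by nlinarith [sq_nonneg ‖x‖]) (by linarith)
  have hwdiff (x y : EuclideanSpace ℝ (Fin 3)) :
      |(w x)⁻¹ * (w y - w x)| ≤ n * (‖x - y‖ * (1 + ‖x - y‖) ^ (2 * n + 1)) := by
    refine le_of_eq_of_le ?_ (abs_one_add_norm_sq_div_rpow_sub_one_le
      (by positivity : 0 ≤ σ / 2) (Nat.le_ceil _) x y)
    congr 1
    rw [mul_sub, inv_mul_cancel₀ (hw0 x).ne', hw, hw, neg_div, Real.rpow_neg (by positivity),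
      Real.rpow_neg (by positivity), inv_inv, Real.div_rpow (by positivity) (by positivity),
      ← div_eq_mul_inv]
  have hC0 : 0 ≤ ∫ z, P z := integral_nonneg hP0
  refine ⟨n * (∫ z, P z) + 1, by positivity, fun k _ f => ?_⟩
  set r : ℝ := 2 ^ k
  have hr1 : 1 ≤ r := one_le_pow₀ one_le_two
  have hr : 0 < r := by positivity
  have hrk : (2 : ℝ) ^ (-(k : ℤ)) = r⁻¹ := by rw [zpow_neg, zpow_natCast]
  have hmi : Integrable fun ξ : EuclideanSpace ℝ (Fin 3) => (φ (r⁻¹ • ξ) : ℂ) :=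
    (integrable_comp_smul_iff volume (fun ξ => (φ ξ : ℂ)) (inv_ne_zero hr.ne')).2 Φ.integrable
  have hΔK (g : EuclideanSpace ℝ (Fin 3) → ℂ) (hg : Integrable g) (x : EuclideanSpace ℝ (Fin 3)) :
      Δ k g x = ∫ y, ((r ^ 3 : ℝ) : ℂ) * K (r • (x - y)) * g y := by
    rw [hΔ, hrk, fourierInv_mul_fourier_eq_integral hmi hg]
    congr with y
    rw [fourierInv_comp_inv_smul (fun ξ => (φ ξ : ℂ)) hr, finrank_euclideanSpace_fin]
    congr 2
    exact congrFun (fourierInv_coe Φ).symm _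
  have hfi : Integrable (f : EuclideanSpace ℝ (Fin 3) → ℂ) := f.integrable
  have hwf : Integrable fun y => (w y : ℂ) * f y := by
    refine hfi.bdd_mul (c := 1) (by fun_prop) (.of_forall fun y => ?_)
    rw [Complex.norm_real, Real.norm_of_nonneg (hw0 y).le]
    exact hw1 y
  have hker (x : EuclideanSpace ℝ (Fin 3)) {g : EuclideanSpace ℝ (Fin 3) → ℂ} (hg : Integrable g) :
      Integrable fun y => ((r ^ 3 : ℝ) : ℂ) * K (r • (x - y)) * g y := by
    refine hg.bdd_mul (c := r ^ 3 * SchwartzMap.seminorm ℝ 0 0 K) (by fun_prop)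
      (.of_forall fun y => ?_)
    rw [norm_mul, Complex.norm_real, Real.norm_of_nonneg (by positivity)]
    gcongr
    exact SchwartzMap.norm_le_seminorm ℝ K _
  set G : EuclideanSpace ℝ (Fin 3) → ENNReal := fun z => ENNReal.ofReal (n * r ^ 3 * r⁻¹ * P (r • z))
  have hGm : Measurable G := by fun_prop
  have hGint : ∫⁻ z, G z = ENNReal.ofReal (n * (∫ z, P z) * r⁻¹) := by
    have hc : 0 ≤ n * r ^ 3 * r⁻¹ := by positivity
    simp only [G, ENNReal.ofReal_mul hc]
    rw [lintegral_const_mul _ (by fun_prop),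
      lintegral_comp_smul_addHaar volume (g := fun z => ENNReal.ofReal (P z)) (by fun_prop) hr.ne',
      ← ofReal_integral_eq_lintegral_ofReal hPi (.of_forall hP0), finrank_euclideanSpace_fin,
      ← ENNReal.ofReal_mul (abs_nonneg _), ← ENNReal.ofReal_mul hc, abs_of_pos (by positivity)]
    congr 1
    field_simp
  have hpt (x : EuclideanSpace ℝ (Fin 3)) :
      ‖((w x : ℂ))⁻¹ * (Δ k (fun y => (w y : ℂ) * f y) x - (w x : ℂ) * Δ k f x)‖ₑ ≤
        ∫⁻ y, G (x - y) * ‖f y‖ₑ := by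
    rw [hΔK _ hwf, hΔK _ hfi, ← integral_const_mul, ← integral_sub (hker x hwf)
      ((hker x hfi).const_mul _), ← integral_const_mul]
    refine (enorm_integral_le_lintegral_enorm _).trans (lintegral_mono fun y => ?_)
    have e : (w x : ℂ)⁻¹ * (((r ^ 3 : ℝ) : ℂ) * K (r • (x - y)) * ((w y : ℂ) * f y) -
        (w x : ℂ) * (((r ^ 3 : ℝ) : ℂ) * K (r • (x - y)) * f y)) =
        (((r ^ 3 : ℝ) : ℂ) * (((w x)⁻¹ * (w y - w x) : ℝ) : ℂ) * K (r • (x - y))) * f y := by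
      push_cast; ring
    simp only [e]
    rw [enorm_mul]
    gcongr
    rw [← ofReal_norm]
    refine ENNReal.ofReal_le_ofReal ?_
    rw [norm_mul, norm_mul, Complex.norm_real, Complex.norm_real, Real.norm_eq_abs (_ * _),
      Real.norm_of_nonneg (by positivity)]
    simp only [P, norm_smul, Real.norm_of_nonneg hr.le]
    have hd := norm_nonneg (x - y)
    calc _ ≤ r ^ 3 * (n * (‖x - y‖ * (1 + ‖x - y‖) ^ (2 * n + 1))) * ‖K (r • (x - y))‖ := by
          gcongr; exact hwdiff x y
      _ ≤ r ^ 3 * (n * (‖x - y‖ * (1 + r * ‖x - y‖) ^ (2 * n + 1))) * ‖K (r • (x - y))‖ := by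
          gcongr; exact le_mul_of_one_le_left hd hr1
      _ = _ := by field_simp
  have hL2 (g : EuclideanSpace ℝ (Fin 3) → ℂ) :
      eLpNorm g 2 volume = (∫⁻ x, ‖g x‖ₑ ^ (2 : ℝ)) ^ (1 / 2 : ℝ) := by
    rw [eLpNorm_eq_lintegral_rpow_enorm_toReal two_ne_zero ENNReal.ofNat_ne_top,
      ENNReal.toReal_ofNat]
  rw [hL2, hL2]
  calc _ ≤ (∫⁻ x, (∫⁻ y, G (x - y) * ‖f y‖ₑ) ^ (2 : ℝ)) ^ (1 / 2 : ℝ) := by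
        gcongr with x
        exact hpt x
    _ ≤ ((∫⁻ x, G x) ^ (2 : ℝ) * ∫⁻ x, ‖f x‖ₑ ^ (2 : ℝ)) ^ (1 / 2 : ℝ) := by
        gcongr
        exact lintegral_sq_lconvolution_le volume hGm f.continuous.measurable.enorm
    _ = (∫⁻ x, G x) * (∫⁻ x, ‖f x‖ₑ ^ (2 : ℝ)) ^ (1 / 2 : ℝ) := by
        rw [ENNReal.mul_rpow_of_nonneg _ _ (by norm_num), ← ENNReal.rpow_mul]
        norm_num
    _ ≤ _ := by
        rw [hGint, hrk]
        gcongr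
        linarith
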